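/- Let V be a real vector space of dimension k ≥ 2, I, J ⊆ ℝ open intervals, and ε : I → V a smooth curve such that for every t ∈ I the vectors ε(t), …, ε⁽ᵏ⁻¹⁾(t) form a basis of V and ε⁽ᵏ⁾(t) = Σ_{i=0}^{k−2} Bᵢ(t)·ε⁽ⁱ⁾(t) for smooth functions B₀, …, B_{k−2}. Let φ : J → I be a smooth map with φ'(τ) ≠ 0 for all τ, and let g : J → ℝ be a smooth nowhere-vanishing function such that the curve ε̃(τ) = g(τ)·ε(φ(τ)) satisfies ε̃⁽ᵏ⁾(τ) = Σ_{i=0}^{k−2} B̃ᵢ(τ)·ε̃⁽ⁱ⁾(τ) for smooth functions B̃₀, …, B̃_{k−2} on J. Then for every τ ∈ J: B̃_{k−2}(τ) = φ'(τ)²·B_{k−2}(φ(τ)) − (k(k²−1)/6)·S(φ)(τ), where S(φ) = (φ''/(2φ'))' − (φ''/(2φ'))² is the Schwarzian derivative of φ. -/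

import Mathlib

/-- The coefficients of the derivatives of a reparameterized curve `g • ε ∘ φ`: its `n`-th derivative
is `∑ⱼ (g * p ^ j * reparamCoeff w q n j) • iteratedDeriv j ε ∘ φ`, where `p` is the derivative of
`φ`, and `w` and `q` are the logarithmic derivatives of `g` and `p`. -/
noncomputable def reparamCoeff (w q : ℝ → ℝ) : ℕ → ℕ → ℝ → ℝ
  | 0, 0 => fun _ => 1
  | 0, _ + 1 => fun _ => 0
  | n + 1, 0 => fun τ => deriv (reparamCoeff w q n 0) τ + w τ * reparamCoeff w q n 0 τ
  | n + 1, j + 1 => fun τ => deriv (reparamCoeff w q n (j + 1)) τ +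
      (w τ + (j + 1) * q τ) * reparamCoeff w q n (j + 1) τ + reparamCoeff w q n j τ

namespace reparamCoeff

variable {w q : ℝ → ℝ}

lemma succ_zero (n : ℕ) (τ : ℝ) : reparamCoeff w q (n + 1) 0 τ =
    deriv (reparamCoeff w q n 0) τ + w τ * reparamCoeff w q n 0 τ := rfl

lemma succ_succ (n j : ℕ) (τ : ℝ) : reparamCoeff w q (n + 1) (j + 1) τ =
    deriv (reparamCoeff w q n (j + 1)) τ + (w τ + (j + 1) * q τ) * reparamCoeff w q n (j + 1) τ +
      reparamCoeff w q n j τ := rfl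

lemma eq_zero_of_lt {n j : ℕ} (h : n < j) : reparamCoeff w q n j = fun _ => 0 := by
  induction n generalizing j with
  | zero =>
    obtain ⟨j, rfl⟩ := Nat.exists_eq_succ_of_ne_zero h.ne'
    rfl
  | succ n ih =>
    obtain ⟨j, rfl⟩ := Nat.exists_eq_succ_of_ne_zero (Nat.ne_zero_of_lt h)
    funext τ
    simp [reparamCoeff, ih (show n < j + 1 by omega), ih (show n < j by omega)]

lemma self (n : ℕ) : reparamCoeff w q n n = fun _ => 1 := by
  induction n with
  | zero => rfl
  | succ n ih =>
    funext τ
    simp [reparamCoeff, eq_zero_of_lt (Nat.lt_succ_self n), ih]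

lemma succ_self (n : ℕ) :
    reparamCoeff w q (n + 1) n = fun τ => (n + 1) * w τ + n * (n + 1) / 2 * q τ := by
  induction n with
  | zero =>
    funext τ
    simp [reparamCoeff]
  | succ n ih =>
    funext τ
    rw [succ_succ, ih, self, deriv_const]
    push_cast
    ring

lemma add_two_self (n : ℕ) {τ : ℝ} (hw : DifferentiableAt ℝ w τ) (hq : DifferentiableAt ℝ q τ) :
    reparamCoeff w q (n + 2) n τ =
      (n + 1) * (n + 2) / 2 * (deriv w τ + w τ ^ 2) +
      n * (n + 1) * (n + 2) / 6 * (deriv q τ + 3 * (w τ * q τ) + q τ ^ 2) +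
      (n - 1) * n * (n + 1) * (n + 2) / 8 * q τ ^ 2 := by
  have hd (n : ℕ) : deriv (reparamCoeff w q (n + 1) n) τ =
      (n + 1) * deriv w τ + n * (n + 1) / 2 * deriv q τ := by
    rw [succ_self]
    exact ((hw.hasDerivAt.const_mul _).add (hq.hasDerivAt.const_mul _)).deriv
  induction n with
  | zero =>
    rw [succ_zero, hd, succ_self]
    push_cast
    ring
  | succ n ih =>
    rw [succ_succ, hd, ih, succ_self]
    push_cast
    ring

lemma contDiffOn {J : Set ℝ} (hJ : IsOpen J) (hw : ContDiffOn ℝ (⊤ : ℕ∞) w J)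
    (hq : ContDiffOn ℝ (⊤ : ℕ∞) q J) (n j : ℕ) :
    ContDiffOn ℝ (⊤ : ℕ∞) (reparamCoeff w q n j) J := by
  induction n generalizing j with
  | zero => cases j <;> exact contDiffOn_const
  | succ n ih =>
    have hd (j : ℕ) : ContDiffOn ℝ (⊤ : ℕ∞) (deriv (reparamCoeff w q n j)) J :=
      (ih j).deriv_of_isOpen hJ (by simp)
    cases j with
    | zero => exact (hd 0).add (hw.mul (ih 0))
    | succ j => exact ((hd _).add ((hw.add (contDiffOn_const.mul hq)).mul (ih _))).add (ih j)

end reparamCoeff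

lemma HasDerivAt.mul_pow_of_logDeriv {g p : ℝ → ℝ} {a b τ : ℝ} (hg : HasDerivAt g (a * g τ) τ)
    (hp : HasDerivAt p (b * p τ) τ) (j : ℕ) :
    HasDerivAt (fun σ => g σ * p σ ^ j) ((a + j * b) * (g τ * p τ ^ j)) τ := by
  induction j with
  | zero => simpa using hg
  | succ j ih =>
    refine ((ih.mul hp).congr_deriv ?_).congr_of_eventuallyEq (.of_eq ?_)
    · push_cast
      ring
    · funext σ
      simp only [Pi.mul_apply]
      ring

lemma ContDiffOn.hasDerivAt_iteratedDeriv {V : Type*} [NormedAddCommGroup V] [NormedSpace ℝ V]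
    {ε : ℝ → V} {I : Set ℝ} (hI : IsOpen I) (hε : ContDiffOn ℝ (⊤ : ℕ∞) ε I) (j : ℕ) {t : ℝ}
    (ht : t ∈ I) : HasDerivAt (iteratedDeriv j ε) (iteratedDeriv (j + 1) ε t) t := by
  rw [iteratedDeriv_succ]
  have h : DifferentiableWithinAt ℝ (iteratedDerivWithin j ε I) I t :=
    hε.differentiableOn_iteratedDerivWithin (by exact_mod_cast WithTop.coe_lt_top _)
      hI.uniqueDiffOn t ht
  refine DifferentiableAt.hasDerivAt ?_
  refine (h.differentiableAt (hI.mem_nhds ht)).congr_of_eventuallyEq ?_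
  filter_upwards [hI.mem_nhds ht] with s hs using (iteratedDerivWithin_of_isOpen hI hs).symm

lemma iteratedDeriv_smul_comp_eq_sum_reparamCoeff
    {V : Type*} [NormedAddCommGroup V] [NormedSpace ℝ V]
    {I J : Set ℝ} (hI : IsOpen I) (hJ : IsOpen J) {ε : ℝ → V} {φ g w q : ℝ → ℝ}
    (hε : ContDiffOn ℝ (⊤ : ℕ∞) ε I) (hφ : ContDiffOn ℝ (⊤ : ℕ∞) φ J) (hφJI : Set.MapsTo φ J I)
    (hw : ContDiffOn ℝ (⊤ : ℕ∞) w J) (hq : ContDiffOn ℝ (⊤ : ℕ∞) q J)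
    (hgw : ∀ τ ∈ J, HasDerivAt g (w τ * g τ) τ)
    (hφq : ∀ τ ∈ J, HasDerivAt (deriv φ) (q τ * deriv φ τ) τ)
    (n : ℕ) {τ : ℝ} (hτ : τ ∈ J) :
    iteratedDeriv n (fun σ => g σ • ε (φ σ)) τ =
      ∑ j ∈ Finset.range (n + 1),
        (g τ * deriv φ τ ^ j * reparamCoeff w q n j τ) • iteratedDeriv j ε (φ τ) := by
  induction n generalizing τ with
  | zero => simp [reparamCoeff]
  | succ n ih =>
    have hterm (j : ℕ) := (((hgw τ hτ).mul_pow_of_logDeriv (hφq τ hτ) j).mul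
      (((reparamCoeff.contDiffOn hJ hw hq n j).differentiableOn (by simp)).differentiableAt
        (hJ.mem_nhds hτ)).hasDerivAt).smul
      ((hε.hasDerivAt_iteratedDeriv hI j (hφJI hτ)).scomp τ
        ((hφ.differentiableOn (by simp)).differentiableAt (hJ.mem_nhds hτ)).hasDerivAt)
    have hsum := HasDerivAt.fun_sum (u := Finset.range (n + 1)) fun j _ => hterm j
    rw [iteratedDeriv_succ, Filter.EventuallyEq.deriv_eq (Filter.eventuallyEq_of_mem
      (hJ.mem_nhds hτ) fun σ hσ => ih hσ)]
    refine hsum.deriv.trans ?_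
    let F (j : ℕ) : V := (g τ * deriv φ τ ^ j * (deriv (reparamCoeff w q n j) τ +
      (w τ + j * q τ) * reparamCoeff w q n j τ)) • iteratedDeriv j ε (φ τ)
    have hF : F (n + 1) = 0 := by simp [F, reparamCoeff.eq_zero_of_lt (Nat.lt_succ_self n)]
    have hzero : (g τ * deriv φ τ ^ 0 * reparamCoeff w q (n + 1) 0 τ) • iteratedDeriv 0 ε (φ τ) =
        F 0 := by
      simp [F, reparamCoeff]
    have hrec (j : ℕ) : (g τ * deriv φ τ ^ (j + 1) * reparamCoeff w q (n + 1) (j + 1) τ) •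
          iteratedDeriv (j + 1) ε (φ τ) =
        F (j + 1) + (g τ * deriv φ τ ^ j * reparamCoeff w q n j τ * deriv φ τ) •
          iteratedDeriv (j + 1) ε (φ τ) := by
      simp only [F, ← add_smul, reparamCoeff.succ_succ]
      congr 1
      push_cast
      ring
    rw [Finset.sum_range_succ' _ (n + 1), hzero]
    simp only [hrec]
    rw [Finset.sum_add_distrib (f := fun j => F (j + 1)), add_right_comm,
      ← Finset.sum_range_succ' F, Finset.sum_range_succ F, hF, add_zero, ← Finset.sum_add_distrib]
    refine Finset.sum_congr rfl fun j _ => ?_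
    simp only [F, Function.comp_apply, Pi.mul_apply, smul_smul]
    rw [add_comm]
    congr 2
    ring

/-- If `∑_{j ≤ m + 2} aⱼ eⱼ = ∑_{i ≤ m} cᵢ dᵢ`, where `e_{m + 2} = ∑_{i ≤ m} bᵢ eᵢ` and
`dᵢ = ∑_{j ≤ i} Aᵢⱼ eⱼ`, then comparing coefficients of `e_{m + 1}` and `e_m` gives two relations. -/
lemma LinearIndependent.compare_top_coeffs {V : Type*} [AddCommGroup V] [Module ℝ V] {m : ℕ}
    {e : ℕ → V} (he : LinearIndependent ℝ fun i : Fin (m + 2) => e i) {a b c : ℕ → ℝ}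
    {A : ℕ → ℕ → ℝ} (htop : e (m + 2) = ∑ i ∈ Finset.range (m + 1), b i • e i)
    (h : ∑ j ∈ Finset.range (m + 2 + 1), a j • e j =
      ∑ i ∈ Finset.range (m + 1), c i • ∑ j ∈ Finset.range (i + 1), A i j • e j) :
    a (m + 1) = 0 ∧ a m + a (m + 2) * b m = c m * A m m := by
  have hL (i : ℕ) (hi : i < m + 2) :
      ∃ L : V →ₗ[ℝ] ℝ, ∀ j < m + 2, L (e j) = if j = i then 1 else 0 := by
    obtain ⟨L, hL⟩ := LinearMap.exists_extend
      ((Finsupp.lapply (⟨i, hi⟩ : Fin (m + 2))).comp he.repr)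
    refine ⟨L, fun j hj => ?_⟩
    have hmem : e j ∈ Submodule.span ℝ (Set.range fun i : Fin (m + 2) => e i) :=
      Submodule.subset_span ⟨⟨j, hj⟩, rfl⟩
    have := LinearMap.congr_fun hL ⟨e j, hmem⟩
    simp only [LinearMap.comp_apply, Submodule.subtype_apply] at this
    rw [this]
    simp [he.repr_eq_single ⟨j, hj⟩ ⟨e j, hmem⟩ rfl, Finsupp.single_apply]
  have hsum (L : V →ₗ[ℝ] ℝ) (i : ℕ) (hLi : ∀ j < m + 2, L (e j) = if j = i then 1 else 0)
      (x : ℕ → ℝ) (n : ℕ) (hn : n ≤ m + 2) :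
      L (∑ j ∈ Finset.range n, x j • e j) = if i < n then x i else 0 := by
    rw [map_sum, Finset.sum_congr rfl fun j hj => by
      rw [map_smul, hLi j ((Finset.mem_range.1 hj).trans_le hn)]]
    simp
  have hcmp (L : V →ₗ[ℝ] ℝ) (i : ℕ) (hi : i < m + 2)
      (hLi : ∀ j < m + 2, L (e j) = if j = i then 1 else 0) :
      a i + a (m + 2) * (if i < m + 1 then b i else 0) =
        ∑ l ∈ Finset.range (m + 1), c l * if i < l + 1 then A l i else 0 := by
    have := congrArg L h
    rw [Finset.sum_range_succ, map_add, hsum L i hLi _ _ le_rfl, if_pos hi, map_smul, htop,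
      hsum L i hLi _ _ (by omega), map_sum, Finset.sum_congr rfl fun l hl => by
        rw [map_smul, hsum L i hLi _ _ (by have := Finset.mem_range.1 hl; omega)]] at this
    simpa using this
  obtain ⟨L, hL1⟩ := hL (m + 1) (by omega)
  obtain ⟨M, hM⟩ := hL m (by omega)
  constructor
  · have := hcmp L _ (by omega) hL1
    rw [Finset.sum_eq_zero fun l hl => by
      rw [if_neg (by have := Finset.mem_range.1 hl; omega), mul_zero]] at this
    simpa using this
  · have := hcmp M _ (by omega) hM
    rw [Finset.sum_range_succ, Finset.sum_eq_zero fun l hl => by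
      rw [if_neg (by have := Finset.mem_range.1 hl; omega), mul_zero]] at this
    simpa using this

/-- The reparameterization rule (5.1): if `ε` is the canonical representative of a regular
curve in `ℙV` (`dim V = k`) with respect to the parameter `t`, with
`ε⁽ᵏ⁾ = Σ_{i=0}^{k−2} Bᵢ ε⁽ⁱ⁾`, and `ε̃(τ) = g(τ)ε(φ(τ))` is the canonical representative
with respect to the parameter `τ`, with `ε̃⁽ᵏ⁾ = Σ_{i=0}^{k−2} B̃ᵢ ε̃⁽ⁱ⁾`, then
`B̃_{k−2}(τ) = φ'(τ)² B_{k−2}(φ(τ)) − (k(k²−1)/6) S(φ)(τ)`, where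
`S(φ) = (φ''/(2φ'))' − (φ''/(2φ'))²` is the Schwarzian derivative of `φ`. -/
theorem reparameterization_rule
    {V : Type*} [NormedAddCommGroup V] [NormedSpace ℝ V] [FiniteDimensional ℝ V]
    (k : ℕ) (hk : 2 ≤ k) (hdim : Module.finrank ℝ V = k)
    (I : Set ℝ) (hIopen : IsOpen I) (hIconn : I.OrdConnected)
    (J : Set ℝ) (hJopen : IsOpen J) (hJconn : J.OrdConnected)
    (ε : ℝ → V) (hε : ContDiffOn ℝ (⊤ : ℕ∞) ε I)
    (hreg : ∀ t ∈ I,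
      LinearIndependent ℝ (fun i : Fin k => iteratedDerivWithin (i : ℕ) ε I t) ∧
      Submodule.span ℝ (Set.range fun i : Fin k => iteratedDerivWithin (i : ℕ) ε I t) = ⊤)
    (B : ℕ → ℝ → ℝ) (hB : ∀ i, ContDiffOn ℝ (⊤ : ℕ∞) (B i) I)
    (hcan : ∀ t ∈ I, iteratedDerivWithin k ε I t =
      ∑ i ∈ Finset.range (k - 1), B i t • iteratedDerivWithin i ε I t)
    (φ : ℝ → ℝ) (hφ : ContDiffOn ℝ (⊤ : ℕ∞) φ J) (hφJI : Set.MapsTo φ J I)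
    (hφ' : ∀ τ ∈ J, derivWithin φ J τ ≠ 0)
    (g : ℝ → ℝ) (hg : ContDiffOn ℝ (⊤ : ℕ∞) g J) (hg0 : ∀ τ ∈ J, g τ ≠ 0)
    (Bt : ℕ → ℝ → ℝ) (hBt : ∀ i, ContDiffOn ℝ (⊤ : ℕ∞) (Bt i) J)
    (hcant : ∀ τ ∈ J, iteratedDerivWithin k (fun σ => g σ • ε (φ σ)) J τ =
      ∑ i ∈ Finset.range (k - 1), Bt i τ • iteratedDerivWithin i (fun σ => g σ • ε (φ σ)) J τ) :
    ∀ τ ∈ J,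
      Bt (k - 2) τ =
        (derivWithin φ J τ)^2 * B (k - 2) (φ τ)
          - ((k : ℝ) * ((k : ℝ)^2 - 1) / 6) *
            (derivWithin (fun σ => derivWithin (derivWithin φ J) J σ / (2 * derivWithin φ J σ)) J τ
              - (derivWithin (derivWithin φ J) J τ / (2 * derivWithin φ J τ))^2) := by
  obtain ⟨m, rfl⟩ := Nat.exists_eq_add_of_le' hk
  have hmk : m + 2 - 1 = m + 1 := rfl
  have hmk' : m + 2 - 2 = m := rfl
  rw [hmk] at hcan hcant
  rw [hmk']
  have hd (f : ℝ → ℝ) : Set.EqOn (derivWithin f J) (deriv f) J := fun σ hσ =>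
    derivWithin_of_isOpen hJopen hσ
  have hdd : Set.EqOn (derivWithin (derivWithin φ J) J) (deriv (deriv φ)) J := fun σ hσ => by
    rw [derivWithin_congr (hd φ) (hd φ hσ), hd _ hσ]
  have hφ0 : ∀ τ ∈ J, deriv φ τ ≠ 0 := fun τ hτ => hd φ hτ ▸ hφ' τ hτ
  have hp : ContDiffOn ℝ (⊤ : ℕ∞) (deriv φ) J := hφ.deriv_of_isOpen hJopen (by simp)
  set w : ℝ → ℝ := fun τ => deriv g τ / g τ with hw_def
  set q : ℝ → ℝ := fun τ => deriv (deriv φ) τ / deriv φ τ with hq_def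
  have hw : ContDiffOn ℝ (⊤ : ℕ∞) w J := (hg.deriv_of_isOpen hJopen (by simp)).div hg hg0
  have hq : ContDiffOn ℝ (⊤ : ℕ∞) q J := (hp.deriv_of_isOpen hJopen (by simp)).div hp hφ0
  have hdiff {f : ℝ → ℝ} (hf : ContDiffOn ℝ (⊤ : ℕ∞) f J) {τ : ℝ} (hτ : τ ∈ J) :
      DifferentiableAt ℝ f τ :=
    (hf.differentiableOn (by simp)).differentiableAt (hJopen.mem_nhds hτ)
  have hgw : ∀ τ ∈ J, HasDerivAt g (w τ * g τ) τ := fun τ hτ => by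
    simpa [hw_def, div_mul_cancel₀ _ (hg0 τ hτ)] using (hdiff hg hτ).hasDerivAt
  have hφq : ∀ τ ∈ J, HasDerivAt (deriv φ) (q τ * deriv φ τ) τ := fun τ hτ => by
    simpa [hq_def, div_mul_cancel₀ _ (hφ0 τ hτ)] using (hdiff hp hτ).hasDerivAt
  have hcmp : ∀ τ ∈ J,
      g τ * deriv φ τ ^ (m + 1) * reparamCoeff w q (m + 2) (m + 1) τ = 0 ∧
      g τ * deriv φ τ ^ m * reparamCoeff w q (m + 2) m τ +
        g τ * deriv φ τ ^ (m + 2) * reparamCoeff w q (m + 2) (m + 2) τ * B m (φ τ) =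
        Bt m τ * (g τ * deriv φ τ ^ m * reparamCoeff w q m m τ) := fun τ hτ => by
    have hε' (j : ℕ) : iteratedDerivWithin j ε I (φ τ) = iteratedDeriv j ε (φ τ) :=
      iteratedDerivWithin_of_isOpen hIopen (hφJI hτ)
    have hexp (j : ℕ) := (iteratedDerivWithin_of_isOpen (n := j)
      (f := fun σ => g σ • ε (φ σ)) hJopen hτ).trans
      (iteratedDeriv_smul_comp_eq_sum_reparamCoeff hIopen hJopen hε hφ hφJI hw hq hgw hφq j hτ)
    have hind := (hreg _ (hφJI hτ)).1
    have htop := hcan _ (hφJI hτ)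
    have hrel := hcant τ hτ
    simp only [hε'] at hind htop
    simp only [hexp] at hrel
    exact LinearIndependent.compare_top_coeffs (e := fun j => iteratedDeriv j ε (φ τ)) hind
      (b := fun i => B i (φ τ)) (c := fun i => Bt i τ) htop hrel
  have hwq : ∀ τ ∈ J, w τ = -((m + 1) / 2) * q τ := fun τ hτ => by
    have h := (mul_eq_zero.1 (hcmp τ hτ).1).resolve_left
      (mul_ne_zero (hg0 τ hτ) (pow_ne_zero _ (hφ0 τ hτ)))
    rw [reparamCoeff.succ_self] at h
    push_cast at h
    have hm : (m : ℝ) + 2 ≠ 0 := by positivity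
    apply mul_left_cancel₀ hm
    linear_combination h
  intro τ hτ
  have hqd := (hdiff hq hτ).hasDerivAt
  have hwd : deriv w τ = -((m + 1) / 2) * deriv q τ := by
    rw [Filter.EventuallyEq.deriv_eq (Filter.eventuallyEq_of_mem (hJopen.mem_nhds hτ) hwq)]
    exact (hqd.const_mul _).deriv
  have hhalf : Set.EqOn (fun σ => derivWithin (derivWithin φ J) J σ / (2 * derivWithin φ J σ))
      (fun σ => 1 / 2 * q σ) J := fun σ hσ => by
    simp only [hdd hσ, hd φ hσ, hq_def]
    have := hφ0 σ hσ
    field_simp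
  have hS : derivWithin (fun σ => derivWithin (derivWithin φ J) J σ / (2 * derivWithin φ J σ)) J τ
      = 1 / 2 * deriv q τ := by
    rw [derivWithin_congr hhalf (hhalf hτ), hd _ hτ]
    exact (hqd.const_mul _).deriv
  have hu : derivWithin (derivWithin φ J) J τ / (2 * derivWithin φ J τ) = 1 / 2 * q τ := hhalf hτ
  rw [hS, hu, hd φ hτ]
  have h := (hcmp τ hτ).2
  rw [reparamCoeff.self, reparamCoeff.self,
    reparamCoeff.add_two_self m (hdiff hw hτ) (hdiff hq hτ), hwd, hwq τ hτ] at h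
  apply mul_left_cancel₀ (mul_ne_zero (hg0 τ hτ) (pow_ne_zero m (hφ0 τ hτ)))
  push_cast
  linear_combination -h
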